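/- Let n ≥ 5, a ≥ 0 and p > (n+4+2a)/(n-4). There exists a constant C = C(n,p,a) such that for every smooth stable solution u of Δ²u = |x|^a |u|^{p-1} u on ℝ^n, every x ∈ ℝ^n and every r > 0: ∫_{B_r(x)} u² dy ≤ C r^{n − 2β}, where β = (4+a)/(p-1). -/

import Mathlib

open MeasureTheory Metric Set Filter
open scoped RealInnerProductSpace Topology

noncomputable section

/-- The Laplacian of `u : ℝⁿ → ℝ` at `x`, as the sum of the pure second
partial derivatives in the coordinate directions. -/
def lap (n : ℕ) (u : EuclideanSpace ℝ (Fin n) → ℝ) (x : EuclideanSpace ℝ (Fin n)) : ℝ :=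
  ∑ i : Fin n, iteratedFDeriv ℝ 2 u x ![EuclideanSpace.single i 1, EuclideanSpace.single i 1]

/-- `u` solves `Δ²u = |x|^a |u|^(p-1) u` pointwise on `Ω`. -/
def IsSolutionOn (n : ℕ) (a p : ℝ) (u : EuclideanSpace ℝ (Fin n) → ℝ)
    (Ω : Set (EuclideanSpace ℝ (Fin n))) : Prop :=
  ∀ x ∈ Ω, lap n (lap n u) x = ‖x‖ ^ a * |u x| ^ (p - 1) * u x

/-- `u` is a stable solution on `Ω`:
`p ∫ |x|^a |u|^(p-1) ψ² ≤ ∫ (Δψ)²` for every test function `ψ ∈ C_c^∞(Ω)`. -/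
def StableOn (n : ℕ) (a p : ℝ) (u : EuclideanSpace ℝ (Fin n) → ℝ)
    (Ω : Set (EuclideanSpace ℝ (Fin n))) : Prop :=
  ∀ ψ : EuclideanSpace ℝ (Fin n) → ℝ, ContDiff ℝ (⊤ : ℕ∞) ψ → HasCompactSupport ψ →
    tsupport ψ ⊆ Ω →
    p * ∫ x, ‖x‖ ^ a * |u x| ^ (p - 1) * ψ x ^ 2 ≤ ∫ x, lap n ψ x ^ 2

/-- Surface integral of `f` over the sphere `∂B_r(x)`, with respect to the
`(n-1)`-dimensional Hausdorff measure. -/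
def sphInt (n : ℕ) (x : EuclideanSpace ℝ (Fin n)) (r : ℝ)
    (f : EuclideanSpace ℝ (Fin n) → ℝ) : ℝ :=
  ∫ y in sphere x r, f y ∂(Measure.hausdorffMeasure ((n : ℝ) - 1))

/-- Radial derivative of `u` at `y`, relative to the center `x`. -/
def radDeriv (n : ℕ) (x : EuclideanSpace ℝ (Fin n))
    (u : EuclideanSpace ℝ (Fin n) → ℝ) (y : EuclideanSpace ℝ (Fin n)) : ℝ :=
  ⟪gradient u y, ‖y - x‖⁻¹ • (y - x)⟫

/-- `ℓ₁ = (β+2)(n-4-β) + β(n-2-β)` with `β = (4+a)/(p-1)`. -/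
def ell1 (n : ℕ) (a p : ℝ) : ℝ :=
  let β : ℝ := (4 + a) / (p - 1)
  (β + 2) * ((n : ℝ) - 4 - β) + β * ((n : ℝ) - 2 - β)

/-- `ℓ₂ = β(β+2)(n-4-β)(n-2-β)` with `β = (4+a)/(p-1)`. -/
def ell2 (n : ℕ) (a p : ℝ) : ℝ :=
  let β : ℝ := (4 + a) / (p - 1)
  β * (β + 2) * ((n : ℝ) - 4 - β) * ((n : ℝ) - 2 - β)

/-- The constant `c(n,p,a) = 2(ρ - γ - 1)`, `ρ = n-1-2β`, `γ = β(β-n+2)`. -/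
def cConst (n : ℕ) (a p : ℝ) : ℝ :=
  let β : ℝ := (4 + a) / (p - 1)
  2 * (((n : ℝ) - 1 - 2 * β) - β * (β - (n : ℝ) + 2) - 1)

/-- The rescaled energy `E(r; x, u)` from the monotonicity formula. -/
def energyE (n : ℕ) (a p : ℝ) (u : EuclideanSpace ℝ (Fin n) → ℝ)
    (x : EuclideanSpace ℝ (Fin n)) (r : ℝ) : ℝ :=
  let β : ℝ := (4 + a) / (p - 1)
  r ^ (2 * β + 4 - (n : ℝ)) *
      (∫ y in ball x r,
        (1 / 2) * lap n u y ^ 2 - (1 / (p + 1)) * ‖y‖ ^ a * |u y| ^ (p + 1))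
    + β / 2 * ((n : ℝ) - 2 - β) *
        deriv (fun ρ : ℝ => ρ ^ (2 * β + 1 - (n : ℝ)) * sphInt n x ρ fun y => u y ^ 2) r
    + β / 2 * ((n : ℝ) - 2 - β) *
        deriv (fun ρ : ℝ => ρ ^ (2 * β + 2 - (n : ℝ)) * sphInt n x ρ fun y => u y ^ 2) r
    + r ^ 3 / 2 *
        deriv (fun ρ : ℝ => ρ ^ (2 * β + 1 - (n : ℝ)) *
          sphInt n x ρ fun y => (β * ρ⁻¹ * u y + radDeriv n x u y) ^ 2) r
    + 1 / 2 *
        deriv (fun ρ : ℝ => ρ ^ (2 * β + 4 - (n : ℝ)) *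
          sphInt n x ρ fun y => ‖gradient u y‖ ^ 2 - radDeriv n x u y ^ 2) r
    + 1 / 2 * r ^ (2 * β + 3 - (n : ℝ)) *
        (sphInt n x r fun y => ‖gradient u y‖ ^ 2 - radDeriv n x u y ^ 2)

end

/-- The `i`-th partial derivative of `f : ℝⁿ → ℝ`. -/
noncomputable def partialDeriv {n : ℕ} (i : Fin n) (f : EuclideanSpace ℝ (Fin n) → ℝ)
    (x : EuclideanSpace ℝ (Fin n)) : ℝ :=
  fderiv ℝ f x (EuclideanSpace.single i 1)

/-- The pointwise inner product `∇f · ∇g` in coordinates. -/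
noncomputable def gradInner {n : ℕ} (f g : EuclideanSpace ℝ (Fin n) → ℝ)
    (x : EuclideanSpace ℝ (Fin n)) : ℝ :=
  ∑ i, partialDeriv i f x * partialDeriv i g x

section Calculus

variable {n : ℕ} {f g : EuclideanSpace ℝ (Fin n) → ℝ}

theorem ContDiff.partialDeriv (hf : ContDiff ℝ (⊤ : ℕ∞) f) (i : Fin n) :
    ContDiff ℝ (⊤ : ℕ∞) (partialDeriv i f) := by
  unfold _root_.partialDeriv
  exact (hf.fderiv_right (m := (⊤ : ℕ∞)) (by simp)).clm_apply contDiff_const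

theorem ContDiff.gradInner (hf : ContDiff ℝ (⊤ : ℕ∞) f) (hg : ContDiff ℝ (⊤ : ℕ∞) g) :
    ContDiff ℝ (⊤ : ℕ∞) (gradInner f g) := by
  unfold _root_.gradInner
  exact ContDiff.sum fun i _ => (hf.partialDeriv i).mul (hg.partialDeriv i)

theorem HasCompactSupport.partialDeriv (hf : HasCompactSupport f) (i : Fin n) :
    HasCompactSupport (partialDeriv i f) :=
  (hf.fderiv (𝕜 := ℝ)).comp_left
    (g := fun L : EuclideanSpace ℝ (Fin n) →L[ℝ] ℝ => L (EuclideanSpace.single i 1)) rfl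

theorem lap_eq_sum_partialDeriv (hf : ContDiff ℝ (⊤ : ℕ∞) f) :
    lap n f = fun x => ∑ i, partialDeriv i (partialDeriv i f) x := by
  funext x
  unfold lap
  refine Finset.sum_congr rfl fun i _ => ?_
  rw [iteratedFDeriv_two_apply]
  have hd : DifferentiableAt ℝ (fderiv ℝ f) x :=
    (hf.fderiv_right (m := (⊤ : ℕ∞)) (by simp)).differentiable (by simp) x
  have h : partialDeriv i f = fun y => fderiv ℝ f y (EuclideanSpace.single i 1) := rfl
  rw [partialDeriv, h, fderiv_clm_apply hd (differentiableAt_const _)]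
  simp

theorem ContDiff.lap (hf : ContDiff ℝ (⊤ : ℕ∞) f) : ContDiff ℝ (⊤ : ℕ∞) (lap n f) := by
  rw [lap_eq_sum_partialDeriv hf]
  exact ContDiff.sum fun i _ => (hf.partialDeriv i).partialDeriv i

theorem HasCompactSupport.lap (hc : HasCompactSupport f) (hf : ContDiff ℝ (⊤ : ℕ∞) f) :
    HasCompactSupport (lap n f) := by
  refine hc.mono' fun x hx => ?_
  by_contra h
  apply hx
  rw [lap_eq_sum_partialDeriv hf]
  refine Finset.sum_eq_zero fun i _ => ?_
  refine Function.notMem_support.mp fun h' => h ?_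
  have h1 : tsupport (_root_.partialDeriv i (_root_.partialDeriv i f)) ⊆
      tsupport (_root_.partialDeriv i f) :=
    tsupport_fderiv_apply_subset ℝ _
  have h2 : tsupport (_root_.partialDeriv i f) ⊆ tsupport f := tsupport_fderiv_apply_subset ℝ _
  exact h2 (h1 (subset_tsupport _ h'))

theorem partialDeriv_mul (hf : ContDiff ℝ (⊤ : ℕ∞) f) (hg : ContDiff ℝ (⊤ : ℕ∞) g) (i : Fin n) :
    partialDeriv i (fun x => f x * g x) =
      fun x => f x * partialDeriv i g x + g x * partialDeriv i f x := by
  funext x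
  unfold partialDeriv
  rw [fderiv_fun_mul (hf.differentiable (by simp) x) (hg.differentiable (by simp) x)]
  simp

theorem partialDeriv_add (hf : ContDiff ℝ (⊤ : ℕ∞) f) (hg : ContDiff ℝ (⊤ : ℕ∞) g) (i : Fin n) :
    partialDeriv i (fun x => f x + g x) = fun x => partialDeriv i f x + partialDeriv i g x := by
  funext x
  unfold partialDeriv
  rw [fderiv_fun_add (hf.differentiable (by simp) x) (hg.differentiable (by simp) x)]
  simp

theorem partialDeriv_pow (hf : ContDiff ℝ (⊤ : ℕ∞) f) (m : ℕ) (i : Fin n) :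
    partialDeriv i (fun x => f x ^ m) = fun x => m * f x ^ (m - 1) * partialDeriv i f x := by
  funext x
  unfold partialDeriv
  rw [fderiv_fun_pow m (hf.differentiable (by simp) x)]
  simp

theorem lap_mul (hf : ContDiff ℝ (⊤ : ℕ∞) f) (hg : ContDiff ℝ (⊤ : ℕ∞) g)
    (x : EuclideanSpace ℝ (Fin n)) :
    lap n (fun x => f x * g x) x = f x * lap n g x + g x * lap n f x + 2 * gradInner f g x := by
  rw [lap_eq_sum_partialDeriv (hf.mul hg), lap_eq_sum_partialDeriv hf, lap_eq_sum_partialDeriv hg]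
  simp only [gradInner, Finset.mul_sum, ← Finset.sum_add_distrib]
  refine Finset.sum_congr rfl fun i _ => ?_
  rw [partialDeriv_mul hf hg, partialDeriv_add (hf.mul (hg.partialDeriv i))
    (hg.mul (hf.partialDeriv i)), partialDeriv_mul hf (hg.partialDeriv i),
    partialDeriv_mul hg (hf.partialDeriv i)]
  ring

theorem gradInner_pow_right (hg : ContDiff ℝ (⊤ : ℕ∞) g) (m : ℕ)
    (x : EuclideanSpace ℝ (Fin n)) :
    gradInner f (fun x => g x ^ m) x = m * g x ^ (m - 1) * gradInner f g x := by
  simp only [gradInner, partialDeriv_pow hg, Finset.mul_sum]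
  exact Finset.sum_congr rfl fun i _ => by ring

theorem gradInner_comm (x : EuclideanSpace ℝ (Fin n)) : gradInner f g x = gradInner g f x :=
  Finset.sum_congr rfl fun _ _ => mul_comm _ _

theorem gradInner_self_nonneg (x : EuclideanSpace ℝ (Fin n)) : 0 ≤ gradInner f f x :=
  Finset.sum_nonneg fun _ _ => mul_self_nonneg _

theorem gradInner_sq_le (x : EuclideanSpace ℝ (Fin n)) :
    gradInner f g x ^ 2 ≤ gradInner f f x * gradInner g g x := by
  have h := Finset.sum_mul_sq_le_sq_mul_sq Finset.univ (fun i => partialDeriv i f x)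
    (fun i => partialDeriv i g x)
  simpa [gradInner, sq] using h

theorem lap_pow (hf : ContDiff ℝ (⊤ : ℕ∞) f) (m : ℕ) (x : EuclideanSpace ℝ (Fin n)) :
    lap n (fun x => f x ^ (m + 2)) x =
      (m + 2) * f x ^ (m + 1) * lap n f x + (m + 2) * (m + 1) * f x ^ m * gradInner f f x := by
  rw [lap_eq_sum_partialDeriv (hf.pow _), lap_eq_sum_partialDeriv hf]
  simp only [gradInner, Finset.mul_sum, ← Finset.sum_add_distrib]
  refine Finset.sum_congr rfl fun i _ => ?_
  rw [partialDeriv_pow hf, partialDeriv_mul (contDiff_const.mul (hf.pow _)) (hf.partialDeriv i),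
    partialDeriv_mul contDiff_const (hf.pow _), partialDeriv_pow hf]
  have : partialDeriv i (fun _ : EuclideanSpace ℝ (Fin n) => ((m + 2 : ℕ) : ℝ)) x = 0 := by
    simp [partialDeriv]
  simp only [this, Nat.add_succ_sub_one, Nat.add_sub_cancel]
  push_cast
  ring

theorem lap_sq (hf : ContDiff ℝ (⊤ : ℕ∞) f) (x : EuclideanSpace ℝ (Fin n)) :
    lap n (fun x => f x ^ 2) x = 2 * f x * lap n f x + 2 * gradInner f f x := by
  have := lap_pow hf 0 x
  simpa using this

theorem integral_partialDeriv_mul (hf : ContDiff ℝ (⊤ : ℕ∞) f) (hg : ContDiff ℝ (⊤ : ℕ∞) g)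
    (hc : HasCompactSupport g) (i : Fin n) :
    ∫ x, partialDeriv i f x * g x = -∫ x, f x * partialDeriv i g x := by
  have := integral_mul_fderiv_eq_neg_fderiv_mul_of_integrable (μ := volume) (f := f) (g := g)
    (v := EuclideanSpace.single i 1)
    (((hf.partialDeriv i).continuous.mul hg.continuous).integrable_of_hasCompactSupport
      hc.mul_left)
    ((hf.continuous.mul (hg.partialDeriv i).continuous).integrable_of_hasCompactSupport
      (hc.partialDeriv i).mul_left)
    ((hf.continuous.mul hg.continuous).integrable_of_hasCompactSupport hc.mul_left)
    (fun x _ => hf.differentiable (by simp) x) (fun x _ => hg.differentiable (by simp) x)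
  unfold partialDeriv
  rw [this, neg_neg]

/-- Green's second identity against a compactly supported function. -/
theorem integral_lap_mul (hf : ContDiff ℝ (⊤ : ℕ∞) f) (hg : ContDiff ℝ (⊤ : ℕ∞) g)
    (hc : HasCompactSupport g) :
    ∫ x, lap n f x * g x = ∫ x, f x * lap n g x := by
  rw [lap_eq_sum_partialDeriv hf, lap_eq_sum_partialDeriv hg]
  simp only [Finset.mul_sum, Finset.sum_mul]
  rw [integral_finsetSum, integral_finsetSum]
  · refine Finset.sum_congr rfl fun i _ => ?_
    rw [integral_partialDeriv_mul (hf.partialDeriv i) hg hc,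
      integral_partialDeriv_mul hf (hg.partialDeriv i) (hc.partialDeriv i), neg_neg]
  · exact fun i _ => (hf.continuous.mul
      ((hg.partialDeriv i).partialDeriv i).continuous).integrable_of_hasCompactSupport
      ((hc.partialDeriv i).partialDeriv i).mul_left
  · exact fun i _ => (((hf.partialDeriv i).partialDeriv i).continuous.mul
      hg.continuous).integrable_of_hasCompactSupport hc.mul_left

theorem partialDeriv_comp_smul_sub (c : ℝ) (z : EuclideanSpace ℝ (Fin n))
    (hf : ContDiff ℝ (⊤ : ℕ∞) f) (i : Fin n) :
    partialDeriv i (fun y => f (c • (y - z))) = fun y => c * partialDeriv i f (c • (y - z)) := by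
  funext y
  have h1 : HasFDerivAt (fun y : EuclideanSpace ℝ (Fin n) => c • (y - z))
      (c • ContinuousLinearMap.id ℝ (EuclideanSpace ℝ (Fin n))) y :=
    ((hasFDerivAt_id y).sub_const z).const_smul c
  have h2 := ((hf.differentiable (by simp) (c • (y - z))).hasFDerivAt).comp y h1
  unfold partialDeriv
  have h3 : fderiv ℝ (fun y => f (c • (y - z))) y = _ := h2.fderiv
  rw [h3]
  simp

end Calculus

/-- Smooth cutoffs between concentric balls of radii `r` and `2r`, with scale-invariant
bounds on the first and second derivatives. -/
theorem exists_cutoff (n : ℕ) : ∃ K : ℝ, 0 < K ∧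
    ∀ (x : EuclideanSpace ℝ (Fin n)) (r : ℝ), 0 < r →
      ∃ φ : EuclideanSpace ℝ (Fin n) → ℝ, ContDiff ℝ (⊤ : ℕ∞) φ ∧ HasCompactSupport φ ∧
        (∀ y, 0 ≤ φ y) ∧ (∀ y, φ y ≤ 1) ∧ (∀ y ∈ ball x r, φ y = 1) ∧
        (∀ y, y ∉ ball x (2 * r) → φ y = 0) ∧
        (∀ y, gradInner φ φ y ≤ K / r ^ 2) ∧ (∀ y, |lap n φ y| ≤ K / r ^ 2) := by
  let χ : ContDiffBump (0 : EuclideanSpace ℝ (Fin n)) := ⟨1, 2, one_pos, one_lt_two⟩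
  have hχ : ContDiff ℝ (⊤ : ℕ∞) χ := χ.contDiff
  have hχc : HasCompactSupport χ := χ.hasCompactSupport
  obtain ⟨K₁, hK₁⟩ := (hχ.gradInner hχ).continuous.bounded_above_of_compact_support
    (f := gradInner χ χ) (by
      refine hχc.mono' fun y hy => ?_
      by_contra h
      refine hy (Finset.sum_eq_zero fun i _ => ?_)
      have h2 : tsupport (partialDeriv i χ) ⊆ tsupport χ := tsupport_fderiv_apply_subset ℝ _
      have : partialDeriv i χ y = 0 :=
        Function.notMem_support.mp fun h' => h (h2 (subset_tsupport _ h'))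
      simp [this])
  obtain ⟨K₂, hK₂⟩ := hχ.lap.continuous.bounded_above_of_compact_support (hχc.lap hχ)
  refine ⟨max (max K₁ K₂) 1, by positivity, fun x r hr => ?_⟩
  have hφ : ContDiff ℝ (⊤ : ℕ∞) fun y => χ (r⁻¹ • (y - x)) :=
    hχ.comp ((contDiff_id.sub contDiff_const).const_smul r⁻¹ :
      ContDiff ℝ (⊤ : ℕ∞) fun y => r⁻¹ • (y - x))
  have hz : ∀ y, y ∉ ball x (2 * r) → χ (r⁻¹ • (y - x)) = 0 := fun y hy => by
    refine χ.zero_of_le_dist ?_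
    rw [mem_ball, dist_eq_norm, not_lt] at hy
    change (2 : ℝ) ≤ _
    rw [dist_zero_right, norm_smul, norm_inv, Real.norm_of_nonneg hr.le, inv_mul_eq_div,
      le_div_iff₀ hr]
    exact hy
  refine ⟨fun y => χ (r⁻¹ • (y - x)), hφ, ?_, fun y => χ.nonneg, fun y => χ.le_one, ?_, hz, ?_, ?_⟩
  · exact HasCompactSupport.of_support_subset_isCompact (isCompact_closedBall x (2 * r))
      fun y hy => ball_subset_closedBall (by_contra fun h => hy (hz y h))
  · intro y hy
    refine χ.one_of_mem_closedBall ?_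
    rw [mem_ball, dist_eq_norm] at hy
    change dist _ _ ≤ (1 : ℝ)
    rw [dist_zero_right, norm_smul, norm_inv, Real.norm_of_nonneg hr.le, inv_mul_eq_div,
      div_le_one hr]
    exact hy.le
  · intro y
    have h : gradInner (fun y => χ (r⁻¹ • (y - x))) (fun y => χ (r⁻¹ • (y - x))) y =
        gradInner χ χ (r⁻¹ • (y - x)) / r ^ 2 := by
      simp only [gradInner, partialDeriv_comp_smul_sub _ _ hχ, Finset.sum_div]
      refine Finset.sum_congr rfl fun i _ => ?_
      field_simp
    rw [h]
    gcongr
    exact (le_abs_self _).trans ((hK₁ _).trans ((le_max_left _ _).trans (le_max_left _ _)))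
  · intro y
    have h : lap n (fun y => χ (r⁻¹ • (y - x))) y = lap n χ (r⁻¹ • (y - x)) / r ^ 2 := by
      rw [lap_eq_sum_partialDeriv hφ, lap_eq_sum_partialDeriv hχ]
      simp only [Finset.sum_div, partialDeriv_comp_smul_sub _ _ hχ]
      refine Finset.sum_congr rfl fun i _ => ?_
      have hd : ContDiff ℝ (⊤ : ℕ∞) fun y => partialDeriv i χ (r⁻¹ • (y - x)) :=
        (hχ.partialDeriv i).comp ((contDiff_id.sub contDiff_const).const_smul r⁻¹ :
          ContDiff ℝ (⊤ : ℕ∞) fun y => r⁻¹ • (y - x))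
      rw [partialDeriv_mul contDiff_const hd,
        partialDeriv_comp_smul_sub _ _ (hχ.partialDeriv i)]
      simp only [partialDeriv, fderiv_fun_const]
      simp
      field_simp
    rw [h, abs_div, abs_of_pos (by positivity : 0 < r ^ 2)]
    gcongr
    exact (hK₂ _).trans ((le_max_right _ _).trans (le_max_left _ _))

section Caccioppoli

variable {n : ℕ} {u η φ V : EuclideanSpace ℝ (Fin n) → ℝ}

theorem lap_mul_sq_sub (hu : ContDiff ℝ (⊤ : ℕ∞) u) (hη : ContDiff ℝ (⊤ : ℕ∞) η)
    (x : EuclideanSpace ℝ (Fin n)) :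
    lap n (fun y => u y * η y) x ^ 2 - lap n u x * lap n (fun y => u y * η y ^ 2) x =
      (u x * lap n η x + 2 * gradInner u η x) ^ 2 -
        2 * (u x * lap n u x) * gradInner η η x := by
  rw [lap_mul hu hη, lap_mul hu (hη.pow 2), lap_sq hη, gradInner_pow_right hη]
  push_cast
  ring

theorem gradInner_pow_self (hφ : ContDiff ℝ (⊤ : ℕ∞) φ) (k : ℕ)
    (x : EuclideanSpace ℝ (Fin n)) :
    gradInner (fun y => φ y ^ (k + 2)) (fun y => φ y ^ (k + 2)) x =
      (k + 2) ^ 2 * φ x ^ (2 * k + 2) * gradInner φ φ x := by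
  rw [gradInner_pow_right hφ, gradInner_comm, gradInner_pow_right hφ]
  simp only [Nat.add_succ_sub_one]
  push_cast
  ring

theorem abs_lap_pow_le (hφ : ContDiff ℝ (⊤ : ℕ∞) φ) (k : ℕ) {s : ℝ}
    {x : EuclideanSpace ℝ (Fin n)} (h0 : 0 ≤ φ x) (h1 : φ x ≤ 1)
    (hg : gradInner φ φ x ≤ s) (hl : |lap n φ x| ≤ s) :
    |lap n (fun y => φ y ^ (k + 2)) x| ≤ (k + 2) ^ 2 * s * φ x ^ k := by
  rw [lap_pow hφ]
  have hg0 := gradInner_self_nonneg (f := φ) x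
  have hs : 0 ≤ s := hg0.trans hg
  have hk : 0 ≤ φ x ^ k := pow_nonneg h0 k
  calc _ ≤ |(k + 2) * φ x ^ (k + 1) * lap n φ x| +
        |(k + 2) * (k + 1) * φ x ^ k * gradInner φ φ x| := abs_add_le _ _
    _ = (k + 2) * φ x ^ (k + 1) * |lap n φ x| +
        (k + 2) * (k + 1) * φ x ^ k * gradInner φ φ x := by
      rw [abs_mul, abs_of_nonneg (by positivity : 0 ≤ (k + 2) * φ x ^ (k + 1)),
        abs_of_nonneg (by positivity : 0 ≤ (k + 2) * (k + 1) * φ x ^ k * gradInner φ φ x)]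
    _ ≤ (k + 2) * φ x ^ k * s + (k + 2) * (k + 1) * φ x ^ k * s := by
      gcongr ?_ * ?_ * ?_ + ?_ * ?_
      exact pow_le_pow_of_le_one h0 h1 (Nat.le_succ k)
    _ = _ := by ring

theorem HasCompactSupport.pow_of_ne_zero (hc : HasCompactSupport φ) {j : ℕ} (hj : j ≠ 0) :
    HasCompactSupport fun x => φ x ^ j :=
  hc.comp_left (g := fun t : ℝ => t ^ j) (zero_pow hj)

theorem integrable_mul_pow (hV : Continuous V) (hφ : Continuous φ) (hc : HasCompactSupport φ)
    {j : ℕ} (hj : j ≠ 0) : Integrable fun x => V x * φ x ^ j :=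
  (hV.mul (hφ.pow j)).integrable_of_hasCompactSupport (hc.pow_of_ne_zero hj).mul_left

/-- Absorption of the gradient and bi-Laplacian terms in the Caccioppoli inequality. -/
theorem absorb_energy {p m : ℝ} (hp : 1 < p) (hm : 0 < m) :
    ∃ δ C : ℝ, 0 < δ ∧ 0 < C ∧ ∀ W T G L Q : ℝ, 0 ≤ Q → 0 ≤ T →
      G ≤ δ * L + (1 / (4 * δ) + 2 * m ^ 2) * Q →
      T - W ≤ 8 * m ^ 2 * G + 2 * m ^ 4 * Q + 2 * m ^ 2 * (δ * L + 1 / (4 * δ) * Q) →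
      L ≤ 2 * T + 16 * m ^ 2 * G + 4 * m ^ 4 * Q → p * W ≤ T → W ≤ C * Q := by
  have hp1 : 0 < p - 1 := by linarith
  set q := p / (p - 1) with hq
  have hq0 : 0 < q := by positivity
  set δ := 1 / (2 * ((20 * q + 16) * m ^ 2)) with hδ
  have hδ0 : 0 < δ := by positivity
  set A := 1 / (4 * δ) + 2 * m ^ 2 with hA
  have hA0 : 0 < A := by positivity
  set B := 8 * m ^ 2 * A + 2 * m ^ 4 + 2 * m ^ 2 * (1 / (4 * δ)) with hB
  have hB0 : 0 < B := by positivity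
  set D := 16 * m ^ 2 * A + 4 * m ^ 4 with hD
  refine ⟨δ, q * (10 * m ^ 2 * δ * (2 * (2 * q * B + D)) + B), hδ0, by positivity, ?_⟩
  intro W T G L Q hQ hT h1 h2 h3 h4
  have hm2 : 0 < m ^ 2 := by positivity
  have h2' : T - W ≤ 10 * m ^ 2 * δ * L + B * Q := by
    have := mul_le_mul_of_nonneg_left h1 (by positivity : 0 ≤ 8 * m ^ 2)
    rw [hB]
    linarith
  have h3' : L ≤ 2 * T + 16 * m ^ 2 * δ * L + D * Q := by
    have := mul_le_mul_of_nonneg_left h1 (by positivity : 0 ≤ 16 * m ^ 2)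
    rw [hD]
    linarith
  have h5 : T ≤ q * (10 * m ^ 2 * δ * L + B * Q) := by
    have h6 : T ≤ q * (T - W) := by
      rw [hq, div_mul_eq_mul_div, le_div_iff₀ hp1]
      linarith
    exact h6.trans (by gcongr)
  have h7 : (20 * q + 16) * m ^ 2 * δ = 1 / 2 := by
    rw [hδ]
    field_simp
  have h8 : L ≤ 2 * (2 * q * B + D) * Q := by
    have e : 2 * (q * (10 * m ^ 2 * δ * L + B * Q)) + 16 * m ^ 2 * δ * L =
      ((20 * q + 16) * m ^ 2 * δ) * L + 2 * q * B * Q := by ring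
    rw [h7] at e
    linarith
  have h9 : W ≤ T := by nlinarith
  calc W ≤ q * (10 * m ^ 2 * δ * L + B * Q) := h9.trans h5
    _ ≤ q * (10 * m ^ 2 * δ * (2 * (2 * q * B + D) * Q) + B * Q) := by gcongr
    _ = _ := by ring

/-- Caccioppoli inequality for stable solutions of `Δ²u = V u`, where stability refers to the
quadratic form `∫ (Δψ)² - p ∫ V ψ²`. -/
theorem exists_caccioppoli {p : ℝ} (hp : 1 < p) {k : ℕ} (hk : k ≠ 0) :
    ∃ C : ℝ, 0 < C ∧ ∀ (n : ℕ) (u V φ : EuclideanSpace ℝ (Fin n) → ℝ) (s : ℝ),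
      ContDiff ℝ (⊤ : ℕ∞) u → (∀ x, lap n (lap n u) x = V x * u x) →
      (∀ ψ : EuclideanSpace ℝ (Fin n) → ℝ, ContDiff ℝ (⊤ : ℕ∞) ψ → HasCompactSupport ψ →
        p * ∫ x, V x * ψ x ^ 2 ≤ ∫ x, lap n ψ x ^ 2) →
      ContDiff ℝ (⊤ : ℕ∞) φ → HasCompactSupport φ → (∀ x, 0 ≤ φ x) → (∀ x, φ x ≤ 1) →
      (∀ x, gradInner φ φ x ≤ s) → (∀ x, |lap n φ x| ≤ s) →
      ∫ x, V x * u x ^ 2 * φ x ^ (2 * k + 4) ≤ C * s ^ 2 * ∫ x, u x ^ 2 * φ x ^ (2 * k) := by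
  obtain ⟨δ, C, hδ, hC, H⟩ := absorb_energy hp (by positivity : (0 : ℝ) < k + 2)
  refine ⟨C, hC, fun n u V φ s hu hsol hstab hφ hc h0 h1 hg hl => ?_⟩
  set m : ℝ := (k : ℝ) + 2 with hm
  have hm0 : 0 < m := by positivity
  have hs : 0 ≤ s := (gradInner_self_nonneg (f := φ) 0).trans (hg 0)
  set η : EuclideanSpace ℝ (Fin n) → ℝ := fun y => φ y ^ (k + 2) with hηdef
  have hη : ContDiff ℝ (⊤ : ℕ∞) η := hφ.pow _
  have hηc : HasCompactSupport η := hc.pow_of_ne_zero (by omega)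
  have huη : ContDiff ℝ (⊤ : ℕ∞) fun y => u y * η y := hu.mul hη
  have huηc : HasCompactSupport fun y => u y * η y := hηc.mul_left
  have huη2 : ContDiff ℝ (⊤ : ℕ∞) fun y => u y * η y ^ 2 := hu.mul (hη.pow 2)
  have huη2c : HasCompactSupport fun y => u y * η y ^ 2 := (hηc.pow_of_ne_zero two_ne_zero).mul_left
  have hη2 : ∀ x, η x ^ 2 = φ x ^ (2 * k + 4) := fun x => by rw [hηdef]; ring
  have hh : ∀ x, |lap n η x| ≤ m ^ 2 * s * φ x ^ k := fun x =>
    abs_lap_pow_le hφ k (h0 x) (h1 x) (hg x) (hl x)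
  have he : ∀ x, gradInner η η x ≤ m ^ 2 * s * φ x ^ (2 * k + 2) := fun x => by
    rw [hηdef, gradInner_pow_self hφ]
    have := h0 x
    calc _ ≤ m ^ 2 * φ x ^ (2 * k + 2) * s := by
          gcongr
          exact hg x
      _ = _ := by ring
  have hζ : ∀ x, |lap n (fun y => φ y ^ (2 * k + 2)) x| ≤ 4 * m ^ 2 * s * φ x ^ (2 * k) :=
    fun x => by
      refine (abs_lap_pow_le hφ (2 * k) (h0 x) (h1 x) (hg x) (hl x)).trans ?_
      have := h0 x
      push_cast
      gcongr
      nlinarith [(Nat.cast_nonneg k : (0 : ℝ) ≤ k)]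
  have hcu := hu.continuous
  have hcl := hu.lap.continuous
  have hcφ := hφ.continuous
  have iI : Integrable fun x => u x ^ 2 * φ x ^ (2 * k) :=
    integrable_mul_pow (hcu.pow 2) hcφ hc (by omega)
  have iL : Integrable fun x => lap n u x ^ 2 * φ x ^ (2 * k + 4) :=
    integrable_mul_pow (hcl.pow 2) hcφ hc (by omega)
  have iG : Integrable fun x => gradInner u u x * φ x ^ (2 * k + 2) :=
    integrable_mul_pow (hu.gradInner hu).continuous hcφ hc (by omega)
  have iT : Integrable fun x => lap n (fun y => u y * η y) x ^ 2 :=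
    (huη.lap.continuous.pow 2).integrable_of_hasCompactSupport
      ((huηc.lap huη).pow_of_ne_zero two_ne_zero)
  have iW : Integrable fun x => lap n u x * lap n (fun y => u y * η y ^ 2) x :=
    (hcl.mul huη2.lap.continuous).integrable_of_hasCompactSupport (huη2c.lap huη2).mul_left
  have hW : ∫ x, V x * u x ^ 2 * φ x ^ (2 * k + 4) =
      ∫ x, lap n u x * lap n (fun y => u y * η y ^ 2) x := by
    rw [← integral_lap_mul hu.lap huη2 huη2c]
    refine integral_congr_ae (.of_forall fun x => ?_)
    simp only [hsol, hη2]
    ring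
  have hyoung : ∀ x, s * |u x * lap n u x| * φ x ^ (2 * k + 2) ≤
      δ * (lap n u x ^ 2 * φ x ^ (2 * k + 4)) +
        1 / (4 * δ) * (s ^ 2 * (u x ^ 2 * φ x ^ (2 * k))) := fun x => by
    rw [abs_mul, ← sq_abs (lap n u x), ← sq_abs (u x)]
    have e : δ * (|lap n u x| ^ 2 * φ x ^ (2 * k + 4)) +
        1 / (4 * δ) * (s ^ 2 * (|u x| ^ 2 * φ x ^ (2 * k))) -
        s * (|u x| * |lap n u x|) * φ x ^ (2 * k + 2) =
        δ * (|lap n u x| * φ x ^ (k + 2) - 1 / (2 * δ) * s * |u x| * φ x ^ k) ^ 2 := by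
      field_simp
      ring
    have : 0 ≤ δ * (|lap n u x| * φ x ^ (k + 2) - 1 / (2 * δ) * s * |u x| * φ x ^ k) ^ 2 := by
      positivity
    linarith
  have hP : ∀ x, (u x * lap n η x + 2 * gradInner u η x) ^ 2 ≤
      8 * m ^ 2 * (s * (gradInner u u x * φ x ^ (2 * k + 2))) +
        2 * m ^ 4 * (s ^ 2 * (u x ^ 2 * φ x ^ (2 * k))) := fun x => by
    have a1 : gradInner u η x ^ 2 ≤ gradInner u u x * (m ^ 2 * s * φ x ^ (2 * k + 2)) :=
      (gradInner_sq_le x).trans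
        (mul_le_mul_of_nonneg_left (he x) (gradInner_self_nonneg x))
    have a2 : lap n η x ^ 2 ≤ (m ^ 2 * s * φ x ^ k) ^ 2 := by
      rw [← sq_abs]
      exact pow_le_pow_left₀ (abs_nonneg _) (hh x) 2
    have a3 := mul_le_mul_of_nonneg_left a2 (sq_nonneg (u x))
    calc _ ≤ 2 * (u x ^ 2 * lap n η x ^ 2) + 8 * gradInner u η x ^ 2 := by
          nlinarith [sq_nonneg (u x * lap n η x - 2 * gradInner u η x)]
      _ ≤ 2 * (u x ^ 2 * (m ^ 2 * s * φ x ^ k) ^ 2) +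
          8 * (gradInner u u x * (m ^ 2 * s * φ x ^ (2 * k + 2))) := by gcongr
      _ = _ := by ring
  have hmain := H (∫ x, V x * u x ^ 2 * φ x ^ (2 * k + 4))
    (∫ x, lap n (fun y => u y * η y) x ^ 2) (s * ∫ x, gradInner u u x * φ x ^ (2 * k + 2))
    (∫ x, lap n u x ^ 2 * φ x ^ (2 * k + 4)) (s ^ 2 * ∫ x, u x ^ 2 * φ x ^ (2 * k))
    (mul_nonneg (sq_nonneg s) (integral_nonneg fun x => mul_nonneg (sq_nonneg _)
      (pow_nonneg (h0 x) _)))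
    (integral_nonneg fun x => sq_nonneg _) ?_ ?_ ?_ ?_
  · rwa [mul_assoc]
  · have hζs : ContDiff ℝ (⊤ : ℕ∞) fun y => φ y ^ (2 * k + 2) := hφ.pow _
    have hB := integral_lap_mul (hu.pow 2) hζs (hc.pow_of_ne_zero (by omega))
    have iX : Integrable fun x => u x * lap n u x * φ x ^ (2 * k + 2) :=
      integrable_mul_pow (hcu.mul hcl) hcφ hc (by omega)
    have iZ : Integrable fun x => u x ^ 2 * lap n (fun y => φ y ^ (2 * k + 2)) x :=
      ((hcu.pow 2).mul hζs.lap.continuous).integrable_of_hasCompactSupport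
        (((hc.pow_of_ne_zero (by omega)).lap hζs).mul_left)
    have hB' : ∫ x, lap n (fun y => u y ^ 2) x * φ x ^ (2 * k + 2) =
        2 * (∫ x, u x * lap n u x * φ x ^ (2 * k + 2)) +
          2 * ∫ x, gradInner u u x * φ x ^ (2 * k + 2) := by
      rw [← integral_const_mul, ← integral_const_mul,
        ← integral_add (iX.const_mul 2) (iG.const_mul 2)]
      refine integral_congr_ae (.of_forall fun x => ?_)
      simp only [lap_sq hu]
      ring
    have hG : s * ∫ x, gradInner u u x * φ x ^ (2 * k + 2) =
        ∫ x, (s / 2 * (u x ^ 2 * lap n (fun y => φ y ^ (2 * k + 2)) x) -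
          s * (u x * lap n u x * φ x ^ (2 * k + 2))) := by
      rw [integral_sub (iZ.const_mul _) (iX.const_mul _), integral_const_mul, integral_const_mul]
      linear_combination s / 2 * hB - s / 2 * hB'
    rw [hG, ← integral_const_mul, ← integral_const_mul, ← integral_const_mul,
      ← integral_add (iL.const_mul _) ((iI.const_mul _).const_mul _)]
    refine integral_mono ((iZ.const_mul _).sub (iX.const_mul _))
      ((iL.const_mul _).add ((iI.const_mul _).const_mul _)) fun x => ?_
    have b1 := hyoung x
    have b2 : -(s * (u x * lap n u x * φ x ^ (2 * k + 2))) ≤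
        s * |u x * lap n u x| * φ x ^ (2 * k + 2) := by
      have := mul_le_mul_of_nonneg_left (neg_abs_le (u x * lap n u x))
        (mul_nonneg hs (pow_nonneg (h0 x) (2 * k + 2)))
      linarith
    have b3 : s / 2 * (u x ^ 2 * lap n (fun y => φ y ^ (2 * k + 2)) x) ≤
        s / 2 * (u x ^ 2 * (4 * m ^ 2 * s * φ x ^ (2 * k))) := by
      gcongr
      exact (le_abs_self _).trans (hζ x)
    dsimp only
    linarith
  · have iA : Integrable fun x => 8 * m ^ 2 * (s * (gradInner u u x * φ x ^ (2 * k + 2))) +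
        2 * m ^ 4 * (s ^ 2 * (u x ^ 2 * φ x ^ (2 * k))) :=
      ((iG.const_mul _).const_mul _).add ((iI.const_mul _).const_mul _)
    have iB : Integrable fun x => 2 * m ^ 2 * (δ * (lap n u x ^ 2 * φ x ^ (2 * k + 4)) +
        1 / (4 * δ) * (s ^ 2 * (u x ^ 2 * φ x ^ (2 * k)))) :=
      ((iL.const_mul _).add ((iI.const_mul _).const_mul _)).const_mul _
    rw [hW, ← integral_sub iT iW, ← integral_const_mul s, ← integral_const_mul (s ^ 2),
      ← integral_const_mul, ← integral_const_mul, ← integral_const_mul δ,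
      ← integral_const_mul (1 / (4 * δ)),
      ← integral_add (iL.const_mul _) ((iI.const_mul _).const_mul _), ← integral_const_mul,
      ← integral_add ((iG.const_mul _).const_mul _) ((iI.const_mul _).const_mul _),
      ← integral_add iA iB]
    refine integral_mono (iT.sub iW) (iA.add iB) fun x => ?_
    dsimp only
    rw [lap_mul_sq_sub hu hη]
    have b1 := mul_le_mul_of_nonneg_left (hyoung x) (by positivity : 0 ≤ 2 * m ^ 2)
    have b2 : -(2 * (u x * lap n u x) * gradInner η η x) ≤
        2 * |u x * lap n u x| * (m ^ 2 * s * φ x ^ (2 * k + 2)) := by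
      have c1 := mul_le_mul_of_nonneg_left (he x) (abs_nonneg (u x * lap n u x))
      have c2 := mul_le_mul_of_nonneg_right (neg_abs_le (u x * lap n u x))
        (gradInner_self_nonneg (f := η) x)
      linarith
    have b3 := hP x
    linarith
  · have iA : Integrable fun x => 2 * lap n (fun y => u y * η y) x ^ 2 +
        16 * m ^ 2 * (s * (gradInner u u x * φ x ^ (2 * k + 2))) :=
      (iT.const_mul _).add ((iG.const_mul _).const_mul _)
    rw [← integral_const_mul s, ← integral_const_mul (s ^ 2),
      ← integral_const_mul 2, ← integral_const_mul, ← integral_const_mul (4 * m ^ 4),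
      ← integral_add (iT.const_mul _) ((iG.const_mul _).const_mul _),
      ← integral_add iA ((iI.const_mul _).const_mul _)]
    refine integral_mono iL (iA.add ((iI.const_mul _).const_mul _)) fun x => ?_
    dsimp only
    have b3 := hP x
    have b4 : lap n u x ^ 2 * φ x ^ (2 * k + 4) ≤ 2 * lap n (fun y => u y * η y) x ^ 2 +
        2 * (u x * lap n η x + 2 * gradInner u η x) ^ 2 := by
      rw [lap_mul hu hη, ← hη2]
      nlinarith [sq_nonneg (η x * lap n u x + 2 * (u x * lap n η x + 2 * gradInner u η x))]
    linarith
  · refine le_trans (le_of_eq ?_) (hstab _ huη huηc)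
    congr 1
    refine integral_congr_ae (.of_forall fun x => ?_)
    simp only [← hη2]
    ring

end Caccioppoli

theorem rpow_neg_norm_integrableOn_ball {n : ℕ} (hn : 1 ≤ n) {σ : ℝ} (hσn : σ < n) (ρ : ℝ) :
    IntegrableOn (fun y : EuclideanSpace ℝ (Fin n) => ‖y‖ ^ (-σ)) (ball 0 ρ) := by
  refine integrableOn_ball_of_norm_le_rpow (C := 1) (α := σ) (by simpa using hn)
    (by simpa using hσn) (.of_forall fun y => ?_) (by fun_prop : Measurable _).aestronglyMeasurable
  rw [Real.norm_of_nonneg (Real.rpow_nonneg (norm_nonneg _) _), one_mul]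

theorem setIntegral_ball_norm_rpow_neg {n : ℕ} (σ : ℝ) {ρ : ℝ} (hρ : 0 < ρ) :
    ∫ y in ball (0 : EuclideanSpace ℝ (Fin n)) ρ, ‖y‖ ^ (-σ) =
      ρ ^ ((n : ℝ) - σ) * ∫ y in ball (0 : EuclideanSpace ℝ (Fin n)) 1, ‖y‖ ^ (-σ) := by
  have h := Measure.setIntegral_comp_smul_of_pos (volume : Measure (EuclideanSpace ℝ (Fin n)))
    (fun y => ‖y‖ ^ (-σ)) (ball 0 1) hρ
  rw [smul_unitBall_of_pos hρ] at h
  simp only [norm_smul, Real.norm_of_nonneg hρ.le,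
    Real.mul_rpow hρ.le (norm_nonneg _), integral_const_mul, finrank_euclideanSpace,
    Fintype.card_fin, smul_eq_mul] at h
  rw [Real.rpow_sub hρ, Real.rpow_natCast, div_eq_mul_inv, ← Real.rpow_neg hρ.le, mul_assoc, h]
  field_simp

/-- A negative power of the norm has scale-invariantly bounded integral over all balls, wherever
they are centered. -/
theorem exists_setIntegral_ball_norm_rpow_neg_le {n : ℕ} (hn : 1 ≤ n) {σ : ℝ} (hσ : 0 ≤ σ)
    (hσn : σ < n) : ∃ Λ : ℝ, 0 < Λ ∧ ∀ (x : EuclideanSpace ℝ (Fin n)) (ρ : ℝ), 0 < ρ →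
      IntegrableOn (fun y => ‖y‖ ^ (-σ)) (ball x ρ) ∧
        ∫ y in ball x ρ, ‖y‖ ^ (-σ) ≤ Λ * ρ ^ ((n : ℝ) - σ) := by
  have hf0 : ∀ y : EuclideanSpace ℝ (Fin n), 0 ≤ ‖y‖ ^ (-σ) :=
    fun y => Real.rpow_nonneg (norm_nonneg y) _
  have hI0 : 0 ≤ ∫ y in ball (0 : EuclideanSpace ℝ (Fin n)) 1, ‖y‖ ^ (-σ) :=
    setIntegral_nonneg measurableSet_ball fun y _ => hf0 y
  refine ⟨(volume : Measure (EuclideanSpace ℝ (Fin n))).real (ball 0 1) +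
    (∫ y in ball (0 : EuclideanSpace ℝ (Fin n)) 1, ‖y‖ ^ (-σ)) + 1, by positivity,
    fun x ρ hρ => ?_⟩
  have hi : IntegrableOn (fun y => ‖y‖ ^ (-σ)) (ball x ρ) :=
    (rpow_neg_norm_integrableOn_ball hn hσn (‖x‖ + ρ)).mono_set
      (ball_subset_ball' (by rw [dist_zero_right]; linarith))
  refine ⟨hi, ?_⟩
  have hi0 := rpow_neg_norm_integrableOn_ball hn hσn ρ
  have hind : Integrable ((ball 0 ρ).indicator fun y : EuclideanSpace ℝ (Fin n) => ‖y‖ ^ (-σ)) :=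
    hi0.integrable_indicator measurableSet_ball
  have hcst : IntegrableOn (fun _ : EuclideanSpace ℝ (Fin n) => ρ ^ (-σ)) (ball x ρ) :=
    integrableOn_const measure_ball_lt_top.ne
  calc ∫ y in ball x ρ, ‖y‖ ^ (-σ)
      ≤ ∫ y in ball x ρ, (ρ ^ (-σ) + (ball 0 ρ).indicator (fun y => ‖y‖ ^ (-σ)) y) := by
        refine integral_mono hi (hcst.add hind.integrableOn) fun y => ?_
        dsimp only
        by_cases hy : y ∈ ball (0 : EuclideanSpace ℝ (Fin n)) ρ
        · rw [indicator_of_mem hy]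
          linarith [Real.rpow_nonneg hρ.le (-σ)]
        · rw [indicator_of_notMem hy, add_zero]
          rw [mem_ball_zero_iff, not_lt] at hy
          exact Real.rpow_le_rpow_of_nonpos hρ hy (by linarith)
    _ = (∫ y in ball x ρ, ρ ^ (-σ)) +
        ∫ y in ball x ρ, (ball 0 ρ).indicator (fun y => ‖y‖ ^ (-σ)) y :=
        integral_add hcst hind.integrableOn
    _ ≤ (∫ y in ball x ρ, ρ ^ (-σ)) + ∫ y : EuclideanSpace ℝ (Fin n),
        (ball 0 ρ).indicator (fun y => ‖y‖ ^ (-σ)) y :=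
        add_le_add_right (setIntegral_le_integral hind
          (.of_forall fun y => indicator_nonneg (fun y _ => hf0 y) y)) _
    _ = ((volume : Measure (EuclideanSpace ℝ (Fin n))).real (ball 0 1) +
        (∫ y in ball (0 : EuclideanSpace ℝ (Fin n)) 1, ‖y‖ ^ (-σ))) * ρ ^ ((n : ℝ) - σ) := by
        rw [integral_indicator measurableSet_ball, setIntegral_ball_norm_rpow_neg σ hρ,
          setIntegral_const, measureReal_def, Measure.addHaar_ball_of_pos _ _ hρ,
          finrank_euclideanSpace,
          ENNReal.toReal_mul, ENNReal.toReal_ofReal (by positivity), ← measureReal_def,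
          Fintype.card_fin, smul_eq_mul, Real.rpow_sub hρ, Real.rpow_natCast, Real.rpow_neg hρ.le]
        field_simp
    _ ≤ _ := mul_le_mul_of_nonneg_right (by linarith) (by positivity)

theorem mul_sq_mul_pow_le {p κ w t f : ℝ} {k : ℕ} (hp : 1 < p) (hκ : 0 < κ) (hw : 0 < w)
    (ht : 0 ≤ t) (hf0 : 0 ≤ f) (hf1 : f ≤ 1) (hk : k ≠ 0) (hkp : 4 * (2 / (p - 1)) ≤ 2 * k) :
    κ * (t ^ 2 * f ^ (2 * k)) ≤ 1 / 2 * (w * t ^ (p - 1) * t ^ 2 * f ^ (2 * k + 4)) +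
      κ * (2 * κ) ^ (2 / (p - 1)) * w ^ (-(2 / (p - 1))) := by
  have hp1 : 0 < p - 1 := by linarith
  set θ := 2 / (p - 1) with hθ
  have hθ0 : 0 < θ := by positivity
  rcases le_or_gt (2 * κ) (w * t ^ (p - 1) * f ^ 4) with h | h
  · have h1 := mul_le_mul_of_nonneg_right h (by positivity : 0 ≤ t ^ 2 * f ^ (2 * k))
    have h2 : 0 ≤ κ * (2 * κ) ^ θ * w ^ (-θ) := by positivity
    have e : w * t ^ (p - 1) * f ^ 4 * (t ^ 2 * f ^ (2 * k)) =
      w * t ^ (p - 1) * t ^ 2 * f ^ (2 * k + 4) := by ring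
    linarith
  · have h1 : t ^ 2 * f ^ (2 * k) ≤ (2 * κ) ^ θ * w ^ (-θ) := by
      calc t ^ 2 * f ^ (2 * k) ≤ t ^ 2 * f ^ (4 * θ) := by
            gcongr
            rw [← Real.rpow_natCast f]
            refine Real.rpow_le_rpow_of_exponent_ge_of_imp hf0 hf1 (by push_cast; exact hkp) ?_
            intro _ h0
            exact absurd h0 (by exact_mod_cast (by omega : 2 * k ≠ 0))
        _ = (t ^ (p - 1) * f ^ 4) ^ θ := by
            rw [Real.mul_rpow (by positivity) (by positivity), ← Real.rpow_mul ht,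
              ← Real.rpow_natCast f 4, ← Real.rpow_mul hf0, hθ, mul_div_cancel₀ _ hp1.ne']
            norm_num
        _ ≤ (2 * κ / w) ^ θ := by
            gcongr
            rw [le_div_iff₀ hw]
            linarith
        _ = (2 * κ) ^ θ * w ^ (-θ) := by
            rw [Real.div_rpow (by positivity) hw.le, Real.rpow_neg hw.le, div_eq_mul_inv]
    have h2 := mul_le_mul_of_nonneg_left h1 hκ.le
    have h3 : 0 ≤ w * t ^ (p - 1) * t ^ 2 * f ^ (2 * k + 4) := by positivity
    linarith

/-- `L²` growth estimate `∫_{B_r(x)} u² ≤ C r^(n-2β)` for smooth stable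
solutions in the supercritical range. -/
theorem stmt12 (n : ℕ) (hn : 5 ≤ n) (a p : ℝ) (ha : 0 ≤ a)
    (hpc : ((n : ℝ) + 4 + 2 * a) / ((n : ℝ) - 4) < p) :
    ∃ C : ℝ, 0 < C ∧
      ∀ u : EuclideanSpace ℝ (Fin n) → ℝ, ContDiff ℝ (⊤ : ℕ∞) u →
        IsSolutionOn n a p u Set.univ → StableOn n a p u Set.univ →
        ∀ (x : EuclideanSpace ℝ (Fin n)) (r : ℝ), 0 < r →
          (∫ y in ball x r, u y ^ 2) ≤
            C * r ^ ((n : ℝ) - 2 * ((4 + a) / (p - 1))) := by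
  have hn' : (5 : ℝ) ≤ n := by exact_mod_cast hn
  rw [div_lt_iff₀ (by linarith)] at hpc
  have hp : 1 < p := by
    by_contra! h
    nlinarith
  have hp1 : 0 < p - 1 := by linarith
  set θ := 2 / (p - 1) with hθ
  have hθ0 : 0 < θ := by positivity
  obtain ⟨k, hk⟩ := exists_nat_ge (4 * θ)
  have hk0 : k ≠ 0 := by
    rintro rfl
    norm_num at hk
    linarith
  have hσn : a * θ < n := by
    rw [hθ, ← mul_div_assoc, div_lt_iff₀ hp1]
    nlinarith
  obtain ⟨Λ, hΛ, hball⟩ := exists_setIntegral_ball_norm_rpow_neg_le (by omega : 1 ≤ n)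
    (by positivity : 0 ≤ a * θ) hσn
  obtain ⟨K, hK, hcut⟩ := exists_cutoff n
  obtain ⟨C, hC, hcacc⟩ := exists_caccioppoli hp hk0
  refine ⟨2 * (2 * (C * K ^ 2)) ^ θ * (Λ * 2 ^ ((n : ℝ) - a * θ)), by positivity, ?_⟩
  intro u hu hsol hstab x r hr
  obtain ⟨φ, hφ, hc, h0, h1, hφ1, hφ0, hg, hl⟩ := hcut x r hr
  have hcu := hu.continuous
  have hV : Continuous fun y => ‖y‖ ^ a * |u y| ^ (p - 1) :=
    (continuous_norm.rpow_const fun _ => Or.inr ha).mul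
      (hcu.abs.rpow_const fun _ => Or.inr hp1.le)
  have hW := hcacc n u _ φ (K / r ^ 2) hu (fun y => hsol y (mem_univ y))
    (fun ψ hψ hψc => hstab ψ hψ hψc (subset_univ _)) hφ hc h0 h1 hg hl
  set κ := C * (K / r ^ 2) ^ 2 with hκdef
  have hκ : 0 < κ := by positivity
  obtain ⟨hint, hle⟩ := hball x (2 * r) (by positivity)
  have iI : Integrable fun y => u y ^ 2 * φ y ^ (2 * k) :=
    integrable_mul_pow (hcu.pow 2) hφ.continuous hc (by omega)
  have iW : Integrable fun y => ‖y‖ ^ a * |u y| ^ (p - 1) * u y ^ 2 * φ y ^ (2 * k + 4) :=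
    integrable_mul_pow (hV.mul (hcu.pow 2)) hφ.continuous hc (by omega)
  have iR := hint.integrable_indicator measurableSet_ball
  have : Nonempty (Fin n) := ⟨⟨0, by omega⟩⟩
  have hmono : κ * ∫ y, u y ^ 2 * φ y ^ (2 * k) ≤
      1 / 2 * (∫ y, ‖y‖ ^ a * |u y| ^ (p - 1) * u y ^ 2 * φ y ^ (2 * k + 4)) +
        κ * (2 * κ) ^ θ * ∫ y in ball x (2 * r), ‖y‖ ^ (-(a * θ)) := by
    rw [← integral_indicator measurableSet_ball, ← integral_const_mul, ← integral_const_mul,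
      ← integral_const_mul, ← integral_add (iW.const_mul _) (iR.const_mul _)]
    refine integral_mono_ae (iI.const_mul _) ((iW.const_mul _).add (iR.const_mul _)) ?_
    filter_upwards [Measure.ae_ne volume (0 : EuclideanSpace ℝ (Fin n))] with y hy
    by_cases hyb : y ∈ ball x (2 * r)
    · rw [indicator_of_mem hyb, ← sq_abs (u y), ← mul_neg, Real.rpow_mul (norm_nonneg y)]
      exact mul_sq_mul_pow_le hp hκ (Real.rpow_pos_of_pos (norm_pos_iff.mpr hy) a) (abs_nonneg _)
        (h0 y) (h1 y) hk0 (by linarith [(Nat.cast_nonneg k : (0 : ℝ) ≤ k)])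
    · rw [indicator_of_notMem hyb, hφ0 y hyb]
      simp [hk0]
  have hlow : ∫ y in ball x r, u y ^ 2 ≤ ∫ y, u y ^ 2 * φ y ^ (2 * k) := by
    rw [setIntegral_congr_fun measurableSet_ball (g := fun y => u y ^ 2 * φ y ^ (2 * k))
      fun y hy => by simp [hφ1 y hy]]
    exact setIntegral_le_integral iI
      (.of_forall fun y => mul_nonneg (sq_nonneg _) (pow_nonneg (h0 y) _))
  have hkey : ∫ y, u y ^ 2 * φ y ^ (2 * k) ≤
      2 * (2 * κ) ^ θ * ∫ y in ball x (2 * r), ‖y‖ ^ (-(a * θ)) := by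
    refine le_of_mul_le_mul_left ?_ hκ
    linarith
  have hscale : (2 * κ) ^ θ = (2 * (C * K ^ 2)) ^ θ * r ^ (-(4 * θ)) := by
    have : 2 * κ = 2 * (C * K ^ 2) * r ^ (-4 : ℝ) := by
      rw [hκdef, Real.rpow_neg hr.le, show (4 : ℝ) = (4 : ℕ) by norm_num, Real.rpow_natCast]
      field_simp
    rw [this, Real.mul_rpow (by positivity) (by positivity), ← Real.rpow_mul hr.le, neg_mul]
  calc ∫ y in ball x r, u y ^ 2
      ≤ 2 * (2 * κ) ^ θ * (Λ * (2 * r) ^ ((n : ℝ) - a * θ)) :=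
        hlow.trans (hkey.trans (mul_le_mul_of_nonneg_left hle (by positivity)))
    _ = 2 * (2 * (C * K ^ 2)) ^ θ * (Λ * 2 ^ ((n : ℝ) - a * θ)) *
        (r ^ (-(4 * θ)) * r ^ ((n : ℝ) - a * θ)) := by
        rw [hscale, Real.mul_rpow two_pos.le hr.le]
        ring
    _ = _ := by
        rw [← Real.rpow_add hr]
        congr 2
        rw [hθ]
        field_simp
        ring
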